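/- For every integer q ≥ 1 and all real numbers x, y, z, setting M = max(|x| + |y|, |y| + |z|), one has |P_q(x, y, z)| ≤ (e²/√π) · q^{3/2} · 4^{q} · M^{2q−2} · (x+z)². -/

import Mathlib

open Finset

/-- `a_q(l) = 1/(l!(q-l)!) · 1/(2l-1)`. -/
noncomputable def aCoeff (q l : ℕ) : ℝ :=
  (1 / ((l.factorial : ℝ) * ((q - l).factorial : ℝ))) * (1 / (2 * (l : ℝ) - 1))

/-- `b_q(l₁,l₂,n)`; all factorial arguments are non-negative in the admissible
range (we use truncated subtraction on `ℕ`). -/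
noncomputable def bCoeff (q l₁ l₂ n : ℕ) : ℝ :=
  ((2 * q - 2 * l₁).factorial * (2 * l₁).factorial *
      (2 * q - 2 * l₂).factorial * (2 * l₂).factorial : ℝ) /
    ((2 * q + n - 2 * l₁ - 2 * l₂).factorial * (2 * l₁ - n).factorial *
      (2 * l₂ - n).factorial * n.factorial : ℝ)

/-- `c_q = 2^{4q} (q!)² / (2q · (2q)!)`. -/
noncomputable def cCoeff (q : ℕ) : ℝ :=
  2 ^ (4 * q) * (q.factorial : ℝ) ^ 2 / (2 * (q : ℝ) * ((2 * q).factorial : ℝ))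

/-- The polynomial function `P̃_q(x,y,z)`. -/
noncomputable def Ptilde (q : ℕ) (x y z : ℝ) : ℝ :=
  ∑ l₁ ∈ range (q + 1), ∑ l₂ ∈ range (q + 1),
    aCoeff q l₁ * aCoeff q l₂ *
      ∑ n ∈ Finset.Icc (2 * (l₁ + l₂) - 2 * q) (min (2 * l₁) (2 * l₂)),
        bCoeff q l₁ l₂ n * x ^ (2 * q + n - 2 * l₁ - 2 * l₂) *
          y ^ (2 * (l₁ + l₂) - 2 * n) * z ^ n

/-- `P_q(x,y,z) = P̃_q(x,y,z) + c_q(x^{2q-1}z + (2q-1)x^{2q-2}y²)`. -/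
noncomputable def Ppoly (q : ℕ) (x y z : ℝ) : ℝ :=
  Ptilde q x y z + cCoeff q * (x ^ (2 * q - 1) * z + (2 * (q : ℝ) - 1) * x ^ (2 * q - 2) * y ^ 2)

theorem cast_succ_mul_centralBinom_succ (n : ℕ) :
    ((n : ℝ) + 1) * (n + 1).centralBinom = 2 * (2 * n + 1) * n.centralBinom := by
  exact_mod_cast Nat.succ_mul_centralBinom_succ n

theorem two_mul_cast_sub_one_ne_zero (n : ℕ) : (2 * (n : ℝ) - 1) ≠ 0 := by
  intro h
  have h' : 2 * (n : ℤ) - 1 = 0 := by exact_mod_cast h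
  omega

theorem sum_range_centralBinom_mul_div (L k : ℕ) :
    ((L : ℝ) + k) * ∑ l ∈ range L, ((l.centralBinom : ℝ) * (L + k - l).centralBinom / (2 * l - 1)) =
      -((L.centralBinom : ℝ) * k.centralBinom * L * (2 * k + 1) / (2 * L - 1)) := by
  induction L generalizing k with
  | zero => simp
  | succ L ih =>
    have h := ih (k + 1)
    rw [sum_range_succ, mul_add]
    have e1 : ∀ l, L + 1 + k - l = L + (k + 1) - l := fun l => by omega
    simp only [e1]
    have e2 : L + (k + 1) - L = k + 1 := by omega
    rw [e2]
    push_cast at h ⊢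
    rw [show (L : ℝ) + 1 + k = L + (k + 1) by ring, h]
    have a1 := cast_succ_mul_centralBinom_succ L
    have a2 := cast_succ_mul_centralBinom_succ k
    have n1 := two_mul_cast_sub_one_ne_zero L
    have n2 : 2 * ((L : ℝ) + 1) - 1 ≠ 0 := by exact_mod_cast two_mul_cast_sub_one_ne_zero (L + 1)
    have n3 : (2 * (L : ℝ) + 1) ≠ 0 := by positivity
    have n4 : (k : ℝ) + 1 ≠ 0 := by positivity
    have n5 : (L : ℝ) + 1 ≠ 0 := by positivity
    have b1 : ((L + 1).centralBinom : ℝ) = 2 * (2 * L + 1) * L.centralBinom / (L + 1) := by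
      field_simp; linarith
    have b2 : ((k + 1).centralBinom : ℝ) = 2 * (2 * k + 1) * k.centralBinom / (k + 1) := by
      field_simp; linarith
    rw [b1, b2, show 2 * ((L : ℝ) + 1) - 1 = 2 * L + 1 by ring]
    field_simp
    ring

theorem sum_antidiagonal_centralBinom_mul_div {q : ℕ} (hq : 1 ≤ q) :
    ∑ p ∈ antidiagonal q, ((p.1.centralBinom : ℝ) * p.2.centralBinom / (2 * p.1 - 1)) = 0 := by
  rw [Finset.Nat.sum_antidiagonal_eq_sum_range_succ_mk, sum_range_succ]
  have h := sum_range_centralBinom_mul_div q 0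
  have hq' : (q : ℝ) ≠ 0 := by positivity
  simp only [Nat.cast_zero, add_zero, mul_zero, zero_add, mul_one, Nat.centralBinom_zero,
    Nat.cast_one] at h
  simp only [Nat.sub_self, Nat.centralBinom_zero, Nat.cast_one, mul_one]
  apply mul_left_cancel₀ hq'
  rw [mul_add, h]
  ring

theorem sum_antidiagonal_centralBinom_mul_div_mul {q : ℕ} (hq : 1 ≤ q) :
    ∑ p ∈ antidiagonal (q + 1), ((p.1.centralBinom : ℝ) * p.2.centralBinom /
      ((2 * p.1 - 1) * (2 * p.2 - 1))) = 0 := by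
  have h1 := sum_antidiagonal_centralBinom_mul_div (q := q + 1) (by omega)
  have h2 := h1
  rw [← Finset.Nat.sum_antidiagonal_swap] at h2
  have hq' : (2 * (q : ℝ)) ≠ 0 := by positivity
  apply mul_left_cancel₀ hq'
  rw [mul_zero, ← add_zero (0 : ℝ)]
  nth_rewrite 1 [← h1]
  rw [← h2, mul_sum, ← sum_add_distrib]
  refine sum_congr rfl fun p hp => ?_
  have hp' : (p.1 : ℝ) + p.2 = q + 1 := by exact_mod_cast mem_antidiagonal.1 hp
  have n1 := two_mul_cast_sub_one_ne_zero p.1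
  have n2 := two_mul_cast_sub_one_ne_zero p.2
  simp only [Prod.fst_swap, Prod.snd_swap]
  rw [show (q : ℝ) = p.1 + p.2 - 1 by linarith]
  field_simp
  ring

theorem sum_antidiagonal_centralBinom_mul_div_sq {q : ℕ} (hq : 1 ≤ q) :
    ∑ p ∈ antidiagonal q, ((p.1.centralBinom : ℝ) * p.2.centralBinom / (2 * p.1 - 1) ^ 2) =
      cCoeff q := by
  induction q, hq using Nat.le_induction with
  | base =>
    norm_num [Finset.Nat.antidiagonal_succ, cCoeff, Nat.centralBinom, Nat.choose, Nat.factorial]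
  | succ q hq ih =>
    have hJ := sum_antidiagonal_centralBinom_mul_div_mul hq
    rw [Finset.Nat.sum_antidiagonal_succ'] at hJ ⊢
    have key : (2 * (q : ℝ) + 1) * ∑ p ∈ antidiagonal q, ((p.1.centralBinom : ℝ) *
        (p.2 + 1).centralBinom / (2 * p.1 - 1) ^ 2) =
        8 * q * ∑ p ∈ antidiagonal q, ((p.1.centralBinom : ℝ) * p.2.centralBinom /
          (2 * p.1 - 1) ^ 2) - ∑ p ∈ antidiagonal q, ((p.1.centralBinom : ℝ) *
        (p.2 + 1).centralBinom / ((2 * p.1 - 1) * (2 * ((p.2 + 1 : ℕ) : ℝ) - 1))) := by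
      rw [mul_sum, mul_sum, ← sum_sub_distrib]
      refine sum_congr rfl fun p hp => ?_
      have hp' : (p.1 : ℝ) + p.2 = q := by exact_mod_cast mem_antidiagonal.1 hp
      have n1 := two_mul_cast_sub_one_ne_zero p.1
      have n2 : (2 * (p.2 : ℝ) + 1) ≠ 0 := by positivity
      have n3 : (p.2 : ℝ) + 1 ≠ 0 := by positivity
      have a2 := cast_succ_mul_centralBinom_succ p.2
      have b2 : ((p.2 + 1).centralBinom : ℝ) = 2 * (2 * p.2 + 1) * p.2.centralBinom / (p.2 + 1) := by
        field_simp; linarith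
      rw [b2, ← hp']
      push_cast
      rw [show 2 * ((p.2 : ℝ) + 1) - 1 = 2 * p.2 + 1 by ring]
      field_simp
      ring
    rw [ih] at key
    have n2 : (2 * (q : ℝ) + 1) ≠ 0 := by positivity
    have hq' : (q : ℝ) ≠ 0 := by positivity
    have hc : (2 * (q : ℝ) + 1) * cCoeff (q + 1) = 8 * q * cCoeff q := by
      unfold cCoeff
      rw [show 2 * (q + 1) = 2 * q + 1 + 1 by ring, Nat.factorial_succ (2 * q + 1),
        Nat.factorial_succ (2 * q), Nat.factorial_succ q]
      have : ((2 * q).factorial : ℝ) ≠ 0 := by positivity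
      have n5 : (q : ℝ) + 1 ≠ 0 := by positivity
      push_cast
      rw [show (2 * (q : ℝ) + 1 + 1) = 2 * (q + 1) by ring]
      field_simp
      ring
    apply mul_left_cancel₀ n2
    rw [mul_add, key, hc]
    simp only [Nat.cast_zero, mul_zero, zero_sub, Nat.centralBinom_zero, Nat.cast_one,
      mul_one] at hJ ⊢
    have n4 : (2 * ((q + 1 : ℕ) : ℝ) - 1) = 2 * q + 1 := by push_cast; ring
    rw [n4] at hJ ⊢
    have : (2 * (q : ℝ) + 1) * (((q + 1).centralBinom : ℝ) / (2 * q + 1) ^ 2) =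
      - (((q + 1).centralBinom : ℝ) / ((2 * q + 1) * (-1))) := by
      field_simp
    rw [this]
    linarith

section SymPower

open Polynomial

variable {R S : Type*} [CommRing R] [CommRing S]

/-- The Fischer product of `u^(N-i) v^i` with `(x u + y v)^(N-j) (y u + z v)^j`. -/
noncomputable def fischerEntry (N i j : ℕ) (x y z : R) : R :=
  ((i.factorial * (N - i).factorial : ℕ) : R) *
    ((C x + C y * X) ^ (N - j) * (C y + C z * X) ^ j).coeff i

theorem map_fischerEntry (φ : R →+* S) (N i j : ℕ) (x y z : R) :
    φ (fischerEntry N i j x y z) = fischerEntry N i j (φ x) (φ y) (φ z) := by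
  simp only [fischerEntry, map_mul, map_natCast, ← Polynomial.coeff_map, Polynomial.map_mul,
    Polynomial.map_pow, Polynomial.map_add, Polynomial.map_C, Polynomial.map_X]

theorem fischerEntry_zero (N i j : ℕ) (x z : R) :
    fischerEntry N i j x 0 z =
      if i = j then ((i.factorial * (N - i).factorial : ℕ) : R) * (x ^ (N - i) * z ^ i) else 0 := by
  have : ((C x + C 0 * X) ^ (N - j) * (C 0 + C z * X) ^ j : R[X]) =
      C (x ^ (N - j) * z ^ j) * X ^ j := by
    simp only [C_0, zero_mul, add_zero, zero_add, mul_pow, C_mul, C_pow]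
    ring
  rw [fischerEntry, this, coeff_C_mul, coeff_X_pow]
  split_ifs with h
  · rw [h, mul_one]
  · simp

theorem coeff_C_add_C_mul_X_pow (x y : R) (M a : ℕ) :
    ((C x + C y * X) ^ M).coeff a = x ^ (M - a) * y ^ a * M.choose a := by
  rw [add_comm, add_pow, finsetSum_coeff]
  have h : ∀ m, ((C y * X) ^ m * C x ^ (M - m) * (M.choose m : R[X])).coeff a =
      if m = a then x ^ (M - a) * y ^ a * M.choose a else 0 := by
    intro m
    have : ((C y * X) ^ m * C x ^ (M - m) * (M.choose m : R[X])) =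
        C (x ^ (M - m) * y ^ m * M.choose m) * X ^ m := by
      rw [mul_pow, C_mul, C_mul, C_pow, C_pow, C_eq_natCast]
      ring
    rw [this, coeff_C_mul, coeff_X_pow]
    by_cases hm : m = a
    · simp [hm]
    · simp [hm, Ne.symm hm]
  simp only [h]
  rw [Finset.sum_ite_eq']
  split_ifs with ha
  · rfl
  · rw [Nat.choose_eq_zero_of_lt (by simpa using ha)]; simp

theorem fischerEntry_eq_sum {N i j : ℕ} (hj : j ≤ N) (x y z : R) :
    fischerEntry N i j x y z = ∑ n ∈ Finset.Icc (i + j - N) (min i j),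
      ((i.factorial * (N - i).factorial * ((N - j).choose (i - n) * j.choose n) : ℕ) : R) *
        x ^ (N + n - i - j) * y ^ (i + j - 2 * n) * z ^ n := by
  rw [fischerEntry, coeff_mul, ← Finset.Nat.sum_antidiagonal_swap]
  rw [Finset.Nat.sum_antidiagonal_eq_sum_range_succ_mk, mul_sum]
  symm
  refine Finset.sum_subset_zero_on_sdiff ?_ ?_ ?_
  · intro n hn
    simp only [Finset.mem_Icc, Finset.mem_range] at hn ⊢
    omega
  · intro n hn
    simp only [Finset.mem_sdiff, Finset.mem_Icc, Finset.mem_range] at hn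
    simp only [Prod.swap, coeff_C_add_C_mul_X_pow]
    by_cases h : j < n
    · rw [Nat.choose_eq_zero_of_lt h]; simp
    · rw [Nat.choose_eq_zero_of_lt (show N - j < i - n by omega)]; simp
  · intro n hn
    simp only [Finset.mem_Icc] at hn
    simp only [Prod.swap, coeff_C_add_C_mul_X_pow]
    rw [show N - j - (i - n) = N + n - i - j by omega,
      show i + j - 2 * n = (i - n) + (j - n) by omega, pow_add]
    push_cast
    ring

theorem factorial_mul_choose_mul_choose {N i j n : ℕ} (hj : j ≤ N)
    (hn : n ∈ Finset.Icc (i + j - N) (min i j)) :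
    (i.factorial * (N - i).factorial * ((N - j).choose (i - n) * j.choose n)) *
      ((N + n - i - j).factorial * (i - n).factorial * (j - n).factorial * n.factorial) =
      (N - i).factorial * i.factorial * (N - j).factorial * j.factorial := by
  simp only [Finset.mem_Icc] at hn
  have h1 := Nat.choose_mul_factorial_mul_factorial (show i - n ≤ N - j by omega)
  have h2 := Nat.choose_mul_factorial_mul_factorial (show n ≤ j by omega)
  rw [show N - j - (i - n) = N + n - i - j by omega] at h1
  rw [← h1, ← h2]
  ring

theorem fischerEntry_comm {N i j : ℕ} (hi : i ≤ N) (hj : j ≤ N) (x y z : R) :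
    fischerEntry N i j x y z = fischerEntry N j i x y z := by
  rw [fischerEntry_eq_sum hj, fischerEntry_eq_sum hi, add_comm j i, min_comm j i]
  refine Finset.sum_congr rfl fun n hn => ?_
  have h1 := factorial_mul_choose_mul_choose hj hn
  have h2 := factorial_mul_choose_mul_choose hi (n := n) (by rwa [add_comm, min_comm])
  rw [show N + n - j - i = N + n - i - j by omega] at h2 ⊢
  have e : i.factorial * (N - i).factorial * ((N - j).choose (i - n) * j.choose n) =
      j.factorial * (N - j).factorial * ((N - i).choose (j - n) * i.choose n) := by
    have hpos : 0 < (N + n - i - j).factorial * (i - n).factorial * (j - n).factorial *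
        n.factorial := by positivity
    apply Nat.eq_of_mul_eq_mul_right hpos
    rw [h1, mul_right_comm ((N + n - i - j).factorial) ((i - n).factorial), h2]
    ring
  rw [e]

theorem factorial_mul_coeff_succ {N i : ℕ} (p : R[X]) :
    (((i + 1).factorial * (N + 1 - (i + 1)).factorial : ℕ) : R) * p.coeff i =
      (i + 1) * (((i.factorial * (N - i).factorial : ℕ) : R) * p.coeff i) := by
  rw [Nat.factorial_succ, Nat.add_sub_add_right]
  push_cast
  ring

theorem factorial_mul_factorial_succ_sub {N i : ℕ} (hi : i ≤ N) :
    (i.factorial * (N + 1 - i).factorial : ℕ) =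
      (N + 1 - i) * (i.factorial * (N - i).factorial) := by
  rw [Nat.sub_add_comm hi, Nat.factorial_succ]
  ring

theorem coeff_fischer_eq_zero {N i j : ℕ} (hi : N < i) (hj : j ≤ N) (x y z : R) :
    ((C x + C y * X) ^ (N - j) * (C y + C z * X) ^ j).coeff i = 0 := by
  apply coeff_eq_zero_of_natDegree_lt
  have h : ∀ a b : R, (C a + C b * X).natDegree ≤ 1 := fun a b => by
    rw [add_comm]; exact natDegree_linear_le
  calc _ ≤ (N - j) * 1 + j * 1 := natDegree_mul_le_of_le
            (natDegree_pow_le_of_le _ (h _ _)) (natDegree_pow_le_of_le _ (h _ _))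
    _ < i := by omega

/-- Multiplying by a linear form `a + b X`, on the level of weighted coefficients. -/
theorem factorial_mul_coeff_linear_mul {N i j : ℕ} (hi : i ≤ N + 1) (hj : j ≤ N) (x y z a b : R) :
    ((i.factorial * (N + 1 - i).factorial : ℕ) : R) * ((C a + C b * X) *
      ((C x + C y * X) ^ (N - j) * (C y + C z * X) ^ j)).coeff i =
      ((N + 1 - i : ℕ) : R) * a * fischerEntry N i j x y z +
        i * b * fischerEntry N (i - 1) j x y z := by
  rw [add_mul, coeff_add, mul_assoc, coeff_C_mul, coeff_C_mul, mul_add]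
  congr 1
  · rcases hi.lt_or_eq with h | h
    · rw [factorial_mul_factorial_succ_sub (by omega), fischerEntry]
      push_cast
      ring
    · rw [coeff_fischer_eq_zero (by omega) hj, h]
      simp
  · cases i with
    | zero => simp
    | succ i =>
      rw [mul_comm X, coeff_mul_X, mul_left_comm, factorial_mul_coeff_succ, Nat.add_sub_cancel,
        fischerEntry]
      push_cast
      ring

theorem fischerEntry_succ_right {N i j : ℕ} (hi : i ≤ N + 1) (hj : j ≤ N) (x y z : R) :
    fischerEntry (N + 1) i (j + 1) x y z =
      ((N + 1 - i : ℕ) : R) * y * fischerEntry N i j x y z +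
        i * z * fischerEntry N (i - 1) j x y z := by
  rw [← factorial_mul_coeff_linear_mul hi hj, fischerEntry]
  congr 2
  rw [Nat.add_sub_add_right]
  ring

/-- Derivation of a Fischer product with respect to the entries of the matrix. -/
theorem derivation_fischerEntry (δ : Derivation ℤ R R) {N i j : ℕ} (hi : i ≤ N + 1)
    (hj : j ≤ N + 1) {x y z : R} (hx : δ x = 0) :
    δ (fischerEntry (N + 1) i j x y z) =
      ((i * (N + 1 - j) : ℕ) * fischerEntry N (i - 1) j x y z +
        ((N + 1 - i) * j : ℕ) * fischerEntry N i (j - 1) x y z) * δ y +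
      (i * j : ℕ) * fischerEntry N (i - 1) (j - 1) x y z * δ z := by
  let _ : Differential R := ⟨δ⟩
  have hcoeff : ∀ p : R[X], δ (p.coeff i) = (Differential.mapCoeffs p).coeff i := fun p => by
    rw [Differential.coeff_mapCoeffs]; rfl
  have hC : ∀ a : R, Differential.mapCoeffs (C a) = C (δ a) := fun a => by
    rw [Differential.mapCoeffs_C]; rfl
  rw [fischerEntry, Derivation.leibniz, Derivation.map_natCast, smul_zero, add_zero, smul_eq_mul,
    hcoeff, Derivation.leibniz, Derivation.leibniz_pow, Derivation.leibniz_pow]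
  simp only [map_add, Derivation.leibniz, Differential.mapCoeffs_X, hC, hx, smul_eq_mul, mul_zero,
    zero_add, C_0, nsmul_eq_mul]
  have h1 : ((i.factorial * (N + 1 - i).factorial : ℕ) : R) * ((C x + C y * X) ^ (N + 1 - j) *
      ((j : R[X]) * ((C y + C z * X) ^ (j - 1) * (C (δ y) + X * C (δ z))))).coeff i =
      ((N + 1 - i) * j : ℕ) * fischerEntry N i (j - 1) x y z * δ y +
      (i * j : ℕ) * fischerEntry N (i - 1) (j - 1) x y z * δ z := by
    cases j with
    | zero => simp
    | succ j =>
      have h := factorial_mul_coeff_linear_mul hi (show j ≤ N by omega) x y z (δ y) (δ z)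
      have e : ((C x + C y * X) ^ (N + 1 - (j + 1)) * (((j + 1 : ℕ) : R[X]) *
          ((C y + C z * X) ^ (j + 1 - 1) * (C (δ y) + X * C (δ z))))) =
          ((j + 1 : ℕ) : R[X]) * ((C (δ y) + C (δ z) * X) *
            ((C x + C y * X) ^ (N - j) * (C y + C z * X) ^ j)) := by
        rw [Nat.add_sub_add_right, Nat.add_sub_cancel]; ring
      rw [e, ← C_eq_natCast, coeff_C_mul, mul_left_comm, h, Nat.add_sub_cancel]
      push_cast
      ring
  have h2 : ((i.factorial * (N + 1 - i).factorial : ℕ) : R) * ((C y + C z * X) ^ j *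
      (((N + 1 - j : ℕ) : R[X]) * ((C x + C y * X) ^ (N + 1 - j - 1) * (X * C (δ y))))).coeff i =
      (i * (N + 1 - j) : ℕ) * fischerEntry N (i - 1) j x y z * δ y := by
    rcases hj.lt_or_eq with hj' | hj'
    · have h := factorial_mul_coeff_linear_mul hi (show j ≤ N by omega) x y z 0 (δ y)
      have e : ((C y + C z * X) ^ j *
        (((N + 1 - j : ℕ) : R[X]) * ((C x + C y * X) ^ (N + 1 - j - 1) * (X * C (δ y))))) =
          ((N + 1 - j : ℕ) : R[X]) * ((C 0 + C (δ y) * X) *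
            ((C x + C y * X) ^ (N - j) * (C y + C z * X) ^ j)) := by
        rw [show N + 1 - j - 1 = N - j by omega, C_0]; ring
      rw [e, ← C_eq_natCast, coeff_C_mul, mul_left_comm, h]
      push_cast
      ring
    · simp [hj']
  rw [coeff_add, mul_add, h1, h2]
  ring

theorem fischerEntry_euler {N i j : ℕ} (hi : i ≤ N + 1) (hj : j ≤ N + 1) (x y z : R) :
    ((i * (N + 1 - j) : ℕ) * fischerEntry N (i - 1) j x y z +
        ((N + 1 - i) * j : ℕ) * fischerEntry N i (j - 1) x y z) * y +
      2 * ((i * j : ℕ) * fischerEntry N (i - 1) (j - 1) x y z * z) =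
      (i + j) * fischerEntry (N + 1) i j x y z := by
  have h1 : j * fischerEntry (N + 1) i j x y z =
      ((N + 1 - i) * j : ℕ) * fischerEntry N i (j - 1) x y z * y +
        (i * j : ℕ) * fischerEntry N (i - 1) (j - 1) x y z * z := by
    cases j with
    | zero => simp
    | succ j =>
      rw [fischerEntry_succ_right hi (by omega), Nat.add_sub_cancel]
      push_cast
      ring
  have h2 : i * fischerEntry (N + 1) i j x y z =
      (i * (N + 1 - j) : ℕ) * fischerEntry N (i - 1) j x y z * y +
        (i * j : ℕ) * fischerEntry N (i - 1) (j - 1) x y z * z := by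
    cases i with
    | zero => simp
    | succ i =>
      rw [fischerEntry_comm hi hj, fischerEntry_succ_right hj (by omega), Nat.add_sub_cancel,
        fischerEntry_comm (i := i) (j := j - 1) (by omega) (by omega)]
      rcases hj.lt_or_eq with hj' | hj'
      · rw [fischerEntry_comm (i := i) (j := j) (by omega) (by omega)]
        push_cast
        ring
      · simp only [hj', Nat.sub_self]
        push_cast
        ring
  linear_combination -h1 - h2
theorem sq_add_sq_conformal (x y : R) :
    ((C x + C y * X) ^ 2 + (C y + C (-x) * X) ^ 2 : R[X]) =
      C (x ^ 2 + y ^ 2) * (1 + X ^ 2) := by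
  simp only [C_neg, C_add, C_pow]
  ring

theorem coeff_one_add_X_sq_pow_two_mul (m k : ℕ) :
    ((1 + X ^ 2 : R[X]) ^ m).coeff (2 * k) = m.choose k := by
  have : ((1 + X ^ 2 : R[X]) ^ m) = expand R 2 ((1 + X) ^ m) := by simp
  rw [this, mul_comm, coeff_expand_mul (by norm_num), coeff_one_add_X_pow]

theorem coeff_one_add_X_sq_pow_two_mul_add_one (m k : ℕ) :
    ((1 + X ^ 2 : R[X]) ^ m).coeff (2 * k + 1) = 0 := by
  have : ((1 + X ^ 2 : R[X]) ^ m) = expand R 2 ((1 + X) ^ m) := by simp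
  rw [this, coeff_expand (by norm_num), if_neg (by omega)]

end SymPower

section FischerSum

open Polynomial

variable {R S : Type*} [CommRing R] [Algebra ℝ R] [CommRing S] [Algebra ℝ S]

/-- The Fischer product of `∑ c k u^(N-2k-e) v^(2k+e)` with its pullback by `[[x, y], [y, z]]`. -/
noncomputable def fischerSum (c : ℕ → ℝ) (n N e : ℕ) (x y z : R) : R :=
  ∑ k ∈ range n, ∑ l ∈ range n, (c k * c l) • fischerEntry N (2 * k + e) (2 * l + e) x y z

theorem map_fischerSum (φ : R →ₐ[ℝ] S) (c : ℕ → ℝ) (n N e : ℕ) (x y z : R) :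
    φ (fischerSum c n N e x y z) = fischerSum c n N e (φ x) (φ y) (φ z) := by
  simp only [fischerSum, map_sum, map_smul]
  refine sum_congr rfl fun k _ => sum_congr rfl fun l _ => ?_
  congr 1
  exact map_fischerEntry (φ : R →+* S) _ _ _ _ _ _

theorem Ptilde_eq_fischerSum (q : ℕ) (x y z : ℝ) :
    Ptilde q x y z = fischerSum (aCoeff q) (q + 1) (2 * q) 0 x y z := by
  unfold Ptilde fischerSum
  refine sum_congr rfl fun k hk => sum_congr rfl fun l hl => ?_
  rw [mem_range] at hk hl
  rw [smul_eq_mul, add_zero, add_zero, fischerEntry_eq_sum (by omega)]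
  congr 1
  rw [show 2 * (k + l) = 2 * k + 2 * l by ring]
  refine sum_congr rfl fun n hn => ?_
  congr 3
  rw [bCoeff, div_eq_iff (by positivity)]
  exact_mod_cast (factorial_mul_choose_mul_choose (by omega) hn).symm

theorem sum_add_smul_fischerEntry (c f : ℕ → ℝ) {n N e : ℕ} (h : ∀ k < n, 2 * k + e ≤ N)
    (x y z : R) :
    ∑ k ∈ range n, ∑ l ∈ range n,
      (c k * c l * (f k + f l)) • fischerEntry N (2 * k + e) (2 * l + e) x y z =
    (2 : ℝ) • ∑ k ∈ range n, c k • ∑ l ∈ range n,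
      (c l * f l) • fischerEntry N (2 * k + e) (2 * l + e) x y z := by
  have h1 : ∑ k ∈ range n, ∑ l ∈ range n,
      (c k * c l * f k) • fischerEntry N (2 * k + e) (2 * l + e) x y z =
      ∑ k ∈ range n, ∑ l ∈ range n,
      (c k * c l * f l) • fischerEntry N (2 * k + e) (2 * l + e) x y z := by
    rw [sum_comm]
    refine sum_congr rfl fun k hk => sum_congr rfl fun l hl => ?_
    rw [mem_range] at hk hl
    rw [fischerEntry_comm (h l hl) (h k hk), mul_comm (c l)]
  simp only [mul_add, add_smul, sum_add_distrib, h1, smul_sum, smul_smul]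
  rw [← sum_add_distrib]
  refine sum_congr rfl fun k _ => ?_
  rw [← sum_add_distrib]
  refine sum_congr rfl fun l _ => ?_
  rw [← add_smul]
  congr 1
  ring

theorem derivation_fischerSum_of_eq_zero (δ : Derivation ℝ R R) (c : ℕ → ℝ) {n N e : ℕ}
    (h : ∀ k < n, 2 * k + e ≤ N + 1) {x y z : R} (hx : δ x = 0) (hy : δ y = 0) :
    δ (fischerSum c n (N + 1) e x y z) = (∑ k ∈ range n, ∑ l ∈ range n,
      ((2 * k + e : ℕ) * c k * ((2 * l + e : ℕ) * c l)) •
        fischerEntry N (2 * k + e - 1) (2 * l + e - 1) x y z) * δ z := by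
  simp only [fischerSum, map_sum, Derivation.map_smul, sum_mul]
  refine sum_congr rfl fun k hk => sum_congr rfl fun l hl => ?_
  rw [mem_range] at hk hl
  have := derivation_fischerEntry (δ.restrictScalars ℤ) (h k hk) (h l hl) (y := y) (z := z) hx
  simp only [Derivation.restrictScalars_apply, hy] at this
  rw [this, mul_zero, zero_add, smul_mul_assoc, ← nsmul_eq_mul, smul_mul_assoc,
    ← Nat.cast_smul_eq_nsmul ℝ, smul_smul]
  congr 1
  push_cast
  ring

theorem derivation_fischerSum_euler (δ : Derivation ℝ R R) (c : ℕ → ℝ) {n N e : ℕ}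
    (h : ∀ k < n, 2 * k + e ≤ N + 1) {x y z : R} (hx : δ x = 0) (hy : δ y = 1) (hz : δ z = 0) :
    δ (fischerSum c n (N + 1) e x y z) * y + 2 * (∑ k ∈ range n, ∑ l ∈ range n,
      ((2 * k + e : ℕ) * c k * ((2 * l + e : ℕ) * c l)) •
        fischerEntry N (2 * k + e - 1) (2 * l + e - 1) x y z) * z =
    ∑ k ∈ range n, ∑ l ∈ range n, (c k * c l * ((2 * k + e : ℕ) + (2 * l + e : ℕ))) •
      fischerEntry (N + 1) (2 * k + e) (2 * l + e) x y z := by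
  simp only [fischerSum, map_sum, Derivation.map_smul, sum_mul, mul_sum]
  rw [← sum_add_distrib]
  refine sum_congr rfl fun k hk => ?_
  rw [← sum_add_distrib]
  refine sum_congr rfl fun l hl => ?_
  rw [mem_range] at hk hl
  have := derivation_fischerEntry (δ.restrictScalars ℤ) (h k hk) (h l hl) (y := y) (z := z) hx
  simp only [Derivation.restrictScalars_apply, hy, hz, mul_zero, add_zero, mul_one] at this
  have he := fischerEntry_euler (h k hk) (h l hl) x y z
  rw [← this] at he
  rw [mul_smul (c k * c l), add_smul, Nat.cast_smul_eq_nsmul, Nat.cast_smul_eq_nsmul,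
    nsmul_eq_mul, nsmul_eq_mul, ← add_mul, ← he, smul_add, smul_mul_assoc]
  congr 1
  rw [show ((2 * k + e : ℕ) * c k * ((2 * l + e : ℕ) * c l)) =
    c k * c l * ((2 * k + e) * (2 * l + e) : ℕ) by push_cast; ring, mul_smul,
    Nat.cast_smul_eq_nsmul, nsmul_eq_mul, mul_smul_comm, smul_mul_assoc]
  congr 1
  ring

theorem sum_choose_smul_fischerEntry_even (m i : ℕ) (x y z : R) :
    ∑ l ∈ range (m + 1), (m.choose l : ℝ) • fischerEntry (2 * m) i (2 * l) x y z =
      ((i.factorial * (2 * m - i).factorial : ℕ) : R) *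
        (((C x + C y * X) ^ 2 + (C y + C z * X) ^ 2) ^ m).coeff i := by
  rw [add_comm ((C x + C y * X) ^ 2), add_pow, finsetSum_coeff, mul_sum]
  refine sum_congr rfl fun l _ => ?_
  rw [fischerEntry, Nat.cast_smul_eq_nsmul, nsmul_eq_mul, ← pow_mul, ← pow_mul, Nat.mul_sub,
    mul_comm _ ((m.choose l : ℕ) : R[X]), ← C_eq_natCast, coeff_C_mul,
    mul_comm ((C y + C z * X) ^ _)]
  ring

theorem sum_choose_smul_fischerEntry_odd (m i : ℕ) (x y z : R) :
    ∑ l ∈ range (m + 1), (m.choose l : ℝ) • fischerEntry (2 * m + 1) i (2 * l + 1) x y z =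
      ((i.factorial * (2 * m + 1 - i).factorial : ℕ) : R) *
        ((C y + C z * X) * ((C x + C y * X) ^ 2 + (C y + C z * X) ^ 2) ^ m).coeff i := by
  rw [add_comm ((C x + C y * X) ^ 2), add_pow, mul_sum, finsetSum_coeff, mul_sum]
  refine sum_congr rfl fun l _ => ?_
  have e : (C y + C z * X) * (((C y + C z * X) ^ 2) ^ l * ((C x + C y * X) ^ 2) ^ (m - l) *
      ((m.choose l : ℕ) : R[X])) = ((m.choose l : ℕ) : R[X]) *
      ((C x + C y * X) ^ (2 * m + 1 - (2 * l + 1)) * (C y + C z * X) ^ (2 * l + 1)) := by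
    rw [Nat.add_sub_add_right, ← Nat.mul_sub, pow_succ _ (2 * l), pow_mul, pow_mul]
    ring
  rw [e, fischerEntry, Nat.cast_smul_eq_nsmul, nsmul_eq_mul, ← C_eq_natCast, coeff_C_mul]
  ring

theorem sum_choose_smul_fischerEntry_even_conformal (m k : ℕ) (x y : R) :
    ∑ l ∈ range (m + 1), (m.choose l : ℝ) • fischerEntry (2 * m) (2 * k) (2 * l) x y (-x) =
      ((2 * k).factorial * (2 * m - 2 * k).factorial * m.choose k : ℝ) •
        (x ^ 2 + y ^ 2) ^ m := by
  rw [sum_choose_smul_fischerEntry_even, sq_add_sq_conformal, mul_pow, ← C_pow, coeff_C_mul,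
    coeff_one_add_X_sq_pow_two_mul, Algebra.smul_def]
  push_cast [map_mul, map_natCast]
  ring

theorem sum_choose_smul_fischerEntry_odd_conformal (m k : ℕ) (x y : R) :
    ∑ l ∈ range (m + 1),
      (m.choose l : ℝ) • fischerEntry (2 * m + 1) (2 * k + 1) (2 * l + 1) x y (-x) =
      ((2 * k + 1).factorial * (2 * m - 2 * k).factorial * m.choose k : ℝ) •
        (-x * (x ^ 2 + y ^ 2) ^ m) := by
  rw [sum_choose_smul_fischerEntry_odd, sq_add_sq_conformal, mul_pow, ← C_pow, add_mul, coeff_add,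
    coeff_C_mul, coeff_C_mul, mul_assoc (C (-x)), coeff_C_mul, mul_comm X, coeff_mul_X,
    coeff_C_mul, coeff_one_add_X_sq_pow_two_mul, coeff_one_add_X_sq_pow_two_mul_add_one,
    Algebra.smul_def, Nat.add_sub_add_right]
  push_cast [map_mul, map_natCast]
  ring

end FischerSum

theorem aCoeff_mul_sub_one {q l : ℕ} (hl : l ≤ q) :
    aCoeff q l * (2 * l - 1) = q.choose l / q.factorial := by
  have := two_mul_cast_sub_one_ne_zero l
  rw [aCoeff, Nat.cast_choose ℝ hl]
  field_simp

theorem aCoeff_sq_mul_factorial {q l : ℕ} (hl : l ≤ q) :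
    aCoeff q l ^ 2 * ((2 * l).factorial * (2 * q - 2 * l).factorial) =
      l.centralBinom * (q - l).centralBinom / (2 * l - 1) ^ 2 := by
  have := two_mul_cast_sub_one_ne_zero l
  rw [aCoeff, Nat.centralBinom, Nat.centralBinom, Nat.cast_choose ℝ (by omega),
    Nat.cast_choose ℝ (by omega), ← Nat.mul_sub, show 2 * l - l = l by omega,
    show 2 * (q - l) - (q - l) = q - l by omega]
  field_simp

theorem aCoeff_succ {q l : ℕ} (hl : l < q) :
    aCoeff q (l + 1) * ((2 * l + 2) * (2 * l + 1)) =
      aCoeff q l * (2 * (q - l) * (2 * l - 1)) := by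
  obtain ⟨k, rfl⟩ : ∃ k, q = l + 1 + k := ⟨q - (l + 1), by omega⟩
  have h := two_mul_cast_sub_one_ne_zero l
  have h' : 2 * (l : ℝ) + 1 ≠ 0 := by positivity
  rw [aCoeff, aCoeff, show l + 1 + k - (l + 1) = k by omega, show l + 1 + k - l = k + 1 by omega,
    Nat.factorial_succ, Nat.factorial_succ]
  push_cast
  rw [show 2 * ((l : ℝ) + 1) - 1 = 2 * l + 1 by ring, show (l : ℝ) + 1 + k - l = k + 1 by ring]
  generalize 2 * (l : ℝ) - 1 = t at h ⊢
  field_simp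

theorem sum_aCoeff_sq_mul_factorial {q : ℕ} (hq : 1 ≤ q) :
    ∑ l ∈ range (q + 1), aCoeff q l ^ 2 * ((2 * l).factorial * (2 * q - 2 * l).factorial) =
      cCoeff q := by
  rw [← sum_antidiagonal_centralBinom_mul_div_sq hq,
    Finset.Nat.sum_antidiagonal_eq_sum_range_succ_mk]
  exact sum_congr rfl fun l hl => aCoeff_sq_mul_factorial (by rw [mem_range] at hl; omega)

theorem sum_aCoeff_sq_mul_factorial_mul {q : ℕ} (hq : 1 ≤ q) :
    ∑ l ∈ range (q + 1), aCoeff q l ^ 2 * ((2 * l).factorial * (2 * q - 2 * l).factorial) *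
      (2 * l - 1) = 0 := by
  rw [← sum_antidiagonal_centralBinom_mul_div hq,
    Finset.Nat.sum_antidiagonal_eq_sum_range_succ_mk]
  refine sum_congr rfl fun l hl => ?_
  rw [aCoeff_sq_mul_factorial (by rw [mem_range] at hl; omega)]
  have := two_mul_cast_sub_one_ne_zero l
  field_simp

theorem sum_aCoeff_sq_mul_factorial_mul_two_mul {q : ℕ} (hq : 1 ≤ q) :
    ∑ l ∈ range (q + 1), aCoeff q l ^ 2 * ((2 * l).factorial * (2 * q - 2 * l).factorial) *
      (2 * l) = cCoeff q := by
  rw [← sum_aCoeff_sq_mul_factorial hq, ← sub_eq_zero, ← sum_sub_distrib,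
    ← sum_aCoeff_sq_mul_factorial_mul hq]
  exact sum_congr rfl fun l _ => by ring

/-- Coefficients of the derivative in `v` of `∑ aCoeff (m+1) l u^(2m+2-2l) v^(2l)`. -/
noncomputable def gradCoeff (m k : ℕ) : ℝ := (2 * k + 2) * aCoeff (m + 1) (k + 1)

/-- Coefficients of the second derivative in `v` of `∑ aCoeff (m+1) l u^(2m+2-2l) v^(2l)`. -/
noncomputable def hessCoeff (m k : ℕ) : ℝ := 2 / m.factorial * m.choose k

theorem mul_gradCoeff {m k : ℕ} (hk : k ≤ m) : (2 * k + 1) * gradCoeff m k = hessCoeff m k := by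
  have h := aCoeff_mul_sub_one (show k + 1 ≤ m + 1 by omega)
  have h2 := Nat.add_one_mul_choose_eq m k
  have h3 : ((m : ℝ) + 1) * m.choose k = (m + 1).choose (k + 1) * (k + 1) := by exact_mod_cast h2
  rw [Nat.factorial_succ] at h
  push_cast at h
  rw [hessCoeff, gradCoeff, show (2 * (k : ℝ) + 1) * ((2 * k + 2) * aCoeff (m + 1) (k + 1)) =
    (2 * k + 2) * (aCoeff (m + 1) (k + 1) * (2 * (k + 1) - 1)) by ring, h]
  field_simp
  linarith

section

open Polynomial

variable {R : Type*} [CommRing R] [Algebra ℝ R]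

theorem sum_mul_aCoeff_eq_fischerSum (m : ℕ) (x y z : R) :
    ∑ k ∈ range (m + 2), ∑ l ∈ range (m + 2),
      ((2 * k + 0 : ℕ) * aCoeff (m + 1) k * ((2 * l + 0 : ℕ) * aCoeff (m + 1) l)) •
        fischerEntry (2 * m + 1) (2 * k + 0 - 1) (2 * l + 0 - 1) x y z =
      fischerSum (gradCoeff m) (m + 1) (2 * m + 1) 1 x y z := by
  rw [sum_range_succ', fischerSum]
  simp only [add_zero, mul_zero, Nat.cast_zero, zero_mul, zero_smul, sum_const_zero]
  refine sum_congr rfl fun k _ => ?_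
  rw [sum_range_succ']
  simp only [mul_zero, Nat.cast_zero, zero_mul, zero_smul, add_zero]
  refine sum_congr rfl fun l _ => ?_
  rw [gradCoeff, gradCoeff, show 2 * (k + 1) - 1 = 2 * k + 1 by omega,
    show 2 * (l + 1) - 1 = 2 * l + 1 by omega]
  push_cast
  congr 1
  ring

theorem sum_mul_gradCoeff_eq_fischerSum (m : ℕ) (x y z : R) :
    ∑ k ∈ range (m + 1), ∑ l ∈ range (m + 1),
      ((2 * k + 1 : ℕ) * gradCoeff m k * ((2 * l + 1 : ℕ) * gradCoeff m l)) •
        fischerEntry (2 * m) (2 * k + 1 - 1) (2 * l + 1 - 1) x y z =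
      fischerSum (hessCoeff m) (m + 1) (2 * m) 0 x y z := by
  refine sum_congr rfl fun k hk => sum_congr rfl fun l hl => ?_
  rw [mem_range] at hk hl
  rw [← mul_gradCoeff (show k ≤ m by omega), ← mul_gradCoeff (show l ≤ m by omega)]
  push_cast
  rfl

theorem fischerSum_hessCoeff_conformal (m : ℕ) : ∃ κ : ℝ, ∀ x y : R,
    fischerSum (hessCoeff m) (m + 1) (2 * m) 0 x y (-x) = κ • (x ^ 2 + y ^ 2) ^ m := by
  refine ⟨∑ k ∈ range (m + 1), hessCoeff m k * (2 / m.factorial * ((2 * k).factorial *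
    (2 * m - 2 * k).factorial * m.choose k)), fun x y => ?_⟩
  rw [fischerSum, sum_smul]
  refine sum_congr rfl fun k _ => ?_
  rw [mul_smul, mul_smul, ← sum_choose_smul_fischerEntry_even_conformal, smul_sum, smul_sum]
  refine sum_congr rfl fun l _ => ?_
  rw [smul_smul, smul_smul, hessCoeff, hessCoeff]
  congr 1
  ring

theorem sum_gradCoeff_conformal (m : ℕ) : ∃ κ : ℝ, ∀ x y : R,
    ∑ k ∈ range (m + 1), gradCoeff m k • ∑ l ∈ range (m + 1),
      (gradCoeff m l * (2 * l + 1 : ℕ)) •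
        fischerEntry (2 * m + 1) (2 * k + 1) (2 * l + 1) x y (-x) =
      κ • (-x * (x ^ 2 + y ^ 2) ^ m) := by
  refine ⟨∑ k ∈ range (m + 1), gradCoeff m k * (2 / m.factorial * ((2 * k + 1).factorial *
    (2 * m - 2 * k).factorial * m.choose k)), fun x y => ?_⟩
  rw [sum_smul]
  refine sum_congr rfl fun k _ => ?_
  rw [mul_smul, mul_smul, ← sum_choose_smul_fischerEntry_odd_conformal]
  congr 1
  rw [smul_sum]
  refine sum_congr rfl fun l hl => ?_
  rw [mem_range] at hl
  rw [smul_smul]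
  congr 1
  rw [← hessCoeff, ← mul_gradCoeff (by omega)]
  push_cast
  ring

theorem sum_aCoeff_conformal {q : ℕ} (hq : 1 ≤ q) (x y : R) :
    ∑ k ∈ range (q + 1), aCoeff q k • ∑ l ∈ range (q + 1),
      (aCoeff q l * (2 * l - 1)) • fischerEntry (2 * q) (2 * k) (2 * l) x y (-x) = 0 := by
  have h : ∀ k ∈ range (q + 1), aCoeff q k • ∑ l ∈ range (q + 1),
      (aCoeff q l * (2 * l - 1)) • fischerEntry (2 * q) (2 * k) (2 * l) x y (-x) =
      (aCoeff q k ^ 2 * ((2 * k).factorial * (2 * q - 2 * k).factorial) * (2 * k - 1)) •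
        (x ^ 2 + y ^ 2) ^ q := by
    intro k hk
    rw [mem_range] at hk
    have e : ∑ l ∈ range (q + 1),
      (aCoeff q l * (2 * l - 1)) • fischerEntry (2 * q) (2 * k) (2 * l) x y (-x) =
        (1 / q.factorial : ℝ) • ∑ l ∈ range (q + 1),
          (q.choose l : ℝ) • fischerEntry (2 * q) (2 * k) (2 * l) x y (-x) := by
      rw [smul_sum]
      refine sum_congr rfl fun l hl => ?_
      rw [mem_range] at hl
      rw [aCoeff_mul_sub_one (by omega), smul_smul]
      congr 1
      ring
    rw [e, sum_choose_smul_fischerEntry_even_conformal, smul_smul, smul_smul]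
    congr 1
    have := aCoeff_mul_sub_one (show k ≤ q by omega)
    linear_combination (-aCoeff q k * ((2 * k).factorial * (2 * q - 2 * k).factorial)) * this
  rw [sum_congr rfl h, ← sum_smul, sum_aCoeff_sq_mul_factorial_mul hq, zero_smul]

theorem fischerSum_zero (c : ℕ → ℝ) (n N e : ℕ) (x z : R) :
    fischerSum c n N e x 0 z = ∑ k ∈ range n,
      (c k ^ 2 * ((2 * k + e).factorial * (N - (2 * k + e)).factorial)) •
        (x ^ (N - (2 * k + e)) * z ^ (2 * k + e)) := by
  refine sum_congr rfl fun k hk => ?_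
  rw [sum_eq_single_of_mem k hk]
  · rw [fischerEntry_zero, if_pos rfl, ← nsmul_eq_mul, ← Nat.cast_smul_eq_nsmul ℝ, smul_smul]
    push_cast
    rw [sq]
  · intro l _ hl
    rw [fischerEntry_zero, if_neg (by omega), smul_zero]

theorem fischerSum_gradCoeff_zero (m : ℕ) (x : ℝ) :
    fischerSum (gradCoeff m) (m + 1) (2 * m + 1) 1 x 0 (-x) =
      -(cCoeff (m + 1) * x ^ (2 * m + 1)) := by
  rw [fischerSum_zero, ← sum_aCoeff_sq_mul_factorial_mul_two_mul (show 1 ≤ m + 1 by omega),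
    sum_range_succ' _ (m + 1), Nat.cast_zero, mul_zero, mul_zero, mul_zero, add_zero, sum_mul, ← sum_neg_distrib]
  refine sum_congr rfl fun k hk => ?_
  rw [mem_range] at hk
  rw [gradCoeff, smul_eq_mul, neg_pow, Odd.neg_one_pow ⟨k, rfl⟩, neg_one_mul, mul_neg, mul_neg,
    ← pow_add, show 2 * m + 1 - (2 * k + 1) + (2 * k + 1) = 2 * m + 1 by omega,
    show 2 * (m + 1) - 2 * (k + 1) = 2 * m + 1 - (2 * k + 1) by omega,
    show 2 * (k + 1) = 2 * k + 1 + 1 by ring, Nat.factorial_succ (2 * k + 1)]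
  push_cast
  ring

theorem fischerSum_aCoeff_zero {q : ℕ} (hq : 1 ≤ q) (x : ℝ) :
    fischerSum (aCoeff q) (q + 1) (2 * q) 0 x 0 (-x) = cCoeff q * x ^ (2 * q) := by
  rw [fischerSum_zero, ← sum_aCoeff_sq_mul_factorial hq, sum_mul]
  refine sum_congr rfl fun k hk => ?_
  rw [mem_range] at hk
  rw [smul_eq_mul, add_zero, Even.neg_pow (even_two_mul k), ← pow_add,
    show 2 * q - 2 * k + 2 * k = 2 * q by omega]

theorem derivative_fischerSum_aCoeff (m : ℕ) (x y : ℝ) :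
    derivative (fischerSum (aCoeff (m + 1)) (m + 1 + 1) (2 * (m + 1)) 0 (C x) (C y) X) =
      fischerSum (gradCoeff m) (m + 1) (2 * m + 1) 1 (C x) (C y) (X : ℝ[X]) := by
  have h := derivation_fischerSum_of_eq_zero (derivative' : Derivation ℝ ℝ[X] ℝ[X])
    (aCoeff (m + 1)) (n := m + 1 + 1) (N := 2 * m + 1) (e := 0) (by omega) (x := C x) (y := C y)
    (z := X) (derivative_C) (derivative_C)
  rw [sum_mul_aCoeff_eq_fischerSum] at h
  rw [derivative'_apply, derivative'_apply, derivative_X, mul_one] at h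
  exact h

theorem derivative_fischerSum_gradCoeff (m : ℕ) (x y : ℝ) :
    derivative (fischerSum (gradCoeff m) (m + 1) (2 * m + 1) 1 (C x) (C y) X) =
      fischerSum (hessCoeff m) (m + 1) (2 * m) 0 (C x) (C y) (X : ℝ[X]) := by
  have h := derivation_fischerSum_of_eq_zero (derivative' : Derivation ℝ ℝ[X] ℝ[X])
    (gradCoeff m) (n := m + 1) (N := 2 * m) (e := 1) (by omega) (x := C x) (y := C y)
    (z := X) (derivative_C) (derivative_C)
  rw [sum_mul_gradCoeff_eq_fischerSum] at h
  rw [derivative'_apply, derivative'_apply, derivative_X, mul_one] at h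
  exact h

theorem fischerSum_gradCoeff_antidiagonal (m : ℕ) (x : ℝ) :
    fischerSum (gradCoeff m) (m + 1) (2 * m + 1) 1 (C x) X (-C x) =
      C (-(cCoeff (m + 1) * x ^ (2 * m + 1))) := by
  set H : ℝ[X] := fischerSum (gradCoeff m) (m + 1) (2 * m + 1) 1 (C x) X (-C x) with hH
  have h := derivation_fischerSum_euler (derivative' : Derivation ℝ ℝ[X] ℝ[X])
    (gradCoeff m) (n := m + 1) (N := 2 * m) (e := 1) (by omega) (x := C x) (y := X)
    (z := -C x) (derivative_C) (derivative_X) (by simp)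
  obtain ⟨κ₁, h₁⟩ := fischerSum_hessCoeff_conformal (R := ℝ[X]) m
  obtain ⟨κ₂, h₂⟩ := sum_gradCoeff_conformal (R := ℝ[X]) m
  rw [sum_mul_gradCoeff_eq_fischerSum, h₁, ← hH,
    sum_add_smul_fischerEntry (gradCoeff m) (fun k => ((2 * k + 1 : ℕ) : ℝ)) (by omega), h₂] at h
  have h' : derivative H * X = C (2 * (κ₁ - κ₂) * x) * (C x ^ 2 + X ^ 2) ^ m := by
    rw [derivative'_apply] at h
    simp only [smul_eq_C_mul] at h
    simp only [C_mul, C_sub, C_ofNat] at h ⊢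
    linear_combination h
  have h0 : 2 * (κ₁ - κ₂) * x = 0 := by
    have := congrArg (eval 0) h'
    simp only [eval_mul, eval_X, mul_zero, eval_C, eval_pow, eval_add, ne_eq,
      OfNat.ofNat_ne_zero, not_false_eq_true, zero_pow, add_zero] at this
    rcases eq_or_ne x 0 with rfl | hx
    · simp
    · exact (mul_eq_zero.1 this.symm).resolve_right (by positivity)
  rw [h0, C_0, zero_mul] at h'
  have hd : derivative H = 0 := (mul_eq_zero.1 h').resolve_right X_ne_zero
  rw [eq_C_of_derivative_eq_zero hd, coeff_zero_eq_eval_zero, ← fischerSum_gradCoeff_zero]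
  congr 1
  have := map_fischerSum (aeval (0 : ℝ)) (gradCoeff m) (m + 1) (2 * m + 1) 1 (C x) X (-C x)
  rw [← hH, coe_aeval_eq_eval] at this
  simpa using this

end

section

open Polynomial

theorem coeff_two_fischerEntry {N i j : ℕ} (hj : j ≤ N) (x z : ℝ) :
    (fischerEntry N i j (C x) X (C z)).coeff 2 = ∑ n ∈ Finset.Icc (i + j - N) (min i j),
      if i + j - 2 * n = 2 then
        ((i.factorial * (N - i).factorial * ((N - j).choose (i - n) * j.choose n) : ℕ) : ℝ) *
          (x ^ (N + n - i - j) * z ^ n) else 0 := by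
  rw [fischerEntry_eq_sum hj, finsetSum_coeff]
  refine sum_congr rfl fun n _ => ?_
  rw [mul_assoc, mul_assoc, ← C_eq_natCast, coeff_C_mul, ← C_pow, ← C_pow, coeff_C_mul,
    coeff_mul_C, coeff_X_pow]
  simp only [eq_comm (a := 2)]
  split_ifs
  · ring
  · ring

theorem coeff_two_fischerEntry_self {q k : ℕ} (hk : k ≤ q) (x : ℝ) :
    (fischerEntry (2 * q) (2 * k) (2 * k) (C x) X (C (-x))).coeff 2 =
      -((2 * k).factorial * (2 * q - 2 * k).factorial * ((2 * k) * (2 * (q - k)))) *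
        x ^ (2 * q - 2) := by
  rw [coeff_two_fischerEntry (by omega)]
  rcases Nat.eq_zero_or_pos k with rfl | hk0
  · simp
  rcases hk.eq_or_lt with rfl | hkq
  · rw [sub_self, mul_zero, mul_zero, mul_zero, neg_zero, zero_mul]
    refine sum_eq_zero fun n hn => ?_
    rw [Finset.mem_Icc] at hn
    rw [if_neg (by omega)]
  · obtain ⟨l, rfl⟩ : ∃ l, k = l + 1 := ⟨k - 1, by omega⟩
    obtain ⟨r, rfl⟩ : ∃ r, q = l + 1 + (r + 1) := ⟨q - (l + 1) - 1, by omega⟩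
    rw [sum_eq_single_of_mem (2 * l + 1) (by rw [Finset.mem_Icc]; omega)]
    · rw [if_pos (by omega), show 2 * (l + 1) - (2 * l + 1) = 1 by omega, Nat.choose_one_right,
        show 2 * (l + 1) = 2 * l + 1 + 1 by ring, Nat.choose_succ_self_right, neg_pow,
        Odd.neg_one_pow ⟨l, rfl⟩, neg_one_mul, mul_neg, ← pow_add,
        show 2 * (l + 1 + (r + 1)) - (2 * l + 1 + 1) = 2 * r + 2 by omega,
        show 2 * (l + 1 + (r + 1)) + (2 * l + 1) - (2 * l + 1 + 1) - (2 * l + 1 + 1) +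
          (2 * l + 1) = 2 * (l + 1 + (r + 1)) - 2 by omega]
      push_cast
      ring
    · intro n _ hn
      rw [if_neg (by omega)]

theorem coeff_two_fischerEntry_succ {q k : ℕ} (hk : k + 1 ≤ q) (x : ℝ) :
    (fischerEntry (2 * q) (2 * k) (2 * (k + 1)) (C x) X (C (-x))).coeff 2 =
      (2 * k).factorial * (2 * q - 2 * k).factorial * ((2 * k + 2) * (2 * k + 1)) / 2 *
        x ^ (2 * q - 2) := by
  rw [coeff_two_fischerEntry (by omega), sum_eq_single_of_mem (2 * k)]
  · have h : (((2 * k + 2).choose (2 * k) : ℕ) : ℝ) = (2 * k + 2) * (2 * k + 1) / 2 := by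
      rw [← Nat.choose_symm_of_eq_add (show 2 * k + 2 = 2 + 2 * k by ring), Nat.cast_choose_two]
      push_cast
      ring
    rw [if_pos (by omega), Nat.sub_self, Nat.choose_zero_right, one_mul,
      Even.neg_pow (even_two_mul k), ← pow_add,
      show 2 * q + 2 * k - 2 * k - 2 * (k + 1) + 2 * k = 2 * q - 2 by omega, Nat.cast_mul,
      show 2 * (k + 1) = 2 * k + 2 by ring, h]
    push_cast
    ring
  · rw [Finset.mem_Icc]
    omega
  · intro n _ hn
    rw [if_neg (by omega)]

theorem coeff_two_fischerEntry_of_lt {q k l : ℕ} (hkl : k + 1 < l) (hl : l ≤ q) (x : ℝ) :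
    (fischerEntry (2 * q) (2 * k) (2 * l) (C x) X (C (-x))).coeff 2 = 0 := by
  rw [coeff_two_fischerEntry (by omega)]
  refine sum_eq_zero fun n hn => ?_
  rw [Finset.mem_Icc] at hn
  rw [if_neg (by omega)]

theorem sum_range_sum_range_tridiagonal (n : ℕ) (g : ℕ → ℕ → ℝ)
    (hsymm : ∀ k ≤ n, ∀ l ≤ n, g k l = g l k) (hfar : ∀ k l, k + 1 < l → l ≤ n → g k l = 0) :
    ∑ k ∈ range (n + 1), ∑ l ∈ range (n + 1), g k l =
      ∑ k ∈ range (n + 1), g k k + 2 * ∑ k ∈ range n, g k (k + 1) := by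
  induction n with
  | zero => simp
  | succ n ih =>
    have h1 : ∑ k ∈ range (n + 1), g k (n + 1) = g n (n + 1) :=
      sum_eq_single_of_mem n (by simp) fun k hk hkn => by
        rw [mem_range] at hk
        exact hfar k (n + 1) (by omega) le_rfl
    have h2 : ∑ k ∈ range (n + 1), g (n + 1) k = g n (n + 1) := by
      rw [← h1]
      refine sum_congr rfl fun k hk => ?_
      rw [mem_range] at hk
      exact hsymm _ le_rfl _ (by omega)
    rw [sum_range_succ]
    simp only [sum_range_succ _ (n + 1)]
    rw [sum_add_distrib, h1, h2, ih (fun k hk l hl => hsymm k (by omega) l (by omega))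
      (fun k l hkl hl => hfar k l hkl (by omega)), sum_range_succ (fun k => g k (k + 1))]
    ring

theorem coeff_two_fischerSum {q : ℕ} (hq : 1 ≤ q) (x : ℝ) :
    (fischerSum (aCoeff q) (q + 1) (2 * q) 0 (C x) X (C (-x))).coeff 2 =
      -((2 * q - 1) * cCoeff q) * x ^ (2 * q - 2) := by
  simp only [fischerSum, finsetSum_coeff, coeff_smul, add_zero]
  rw [sum_range_sum_range_tridiagonal]
  · have h1 : ∀ k ∈ range (q + 1), (aCoeff q k * aCoeff q k) •
        (fischerEntry (2 * q) (2 * k) (2 * k) (C x) X (C (-x))).coeff 2 =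
        aCoeff q k ^ 2 * ((2 * k).factorial * (2 * q - 2 * k).factorial) *
          (-((2 * k) * (2 * (q - k)))) * x ^ (2 * q - 2) := by
      intro k hk
      rw [mem_range] at hk
      rw [coeff_two_fischerEntry_self (by omega), smul_eq_mul]
      ring
    have h2 : ∀ k ∈ range q, (aCoeff q k * aCoeff q (k + 1)) •
        (fischerEntry (2 * q) (2 * k) (2 * (k + 1)) (C x) X (C (-x))).coeff 2 =
        aCoeff q k ^ 2 * ((2 * k).factorial * (2 * q - 2 * k).factorial) *
          ((q - k) * (2 * k - 1)) * x ^ (2 * q - 2) := by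
      intro k hk
      rw [mem_range] at hk
      rw [coeff_two_fischerEntry_succ (by omega), smul_eq_mul]
      have := aCoeff_succ hk
      linear_combination (aCoeff q k * ((2 * k).factorial * (2 * q - 2 * k).factorial) / 2 *
        x ^ (2 * q - 2)) * this
    have h3 : ∑ k ∈ range q, aCoeff q k ^ 2 * ((2 * k).factorial * (2 * q - 2 * k).factorial) *
          ((q - k) * (2 * k - 1)) * x ^ (2 * q - 2) =
        ∑ k ∈ range (q + 1), aCoeff q k ^ 2 * ((2 * k).factorial * (2 * q - 2 * k).factorial) *
          ((q - k) * (2 * k - 1)) * x ^ (2 * q - 2) := by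
      rw [sum_range_succ, sub_self, zero_mul, mul_zero, zero_mul, add_zero]
    rw [sum_congr rfl h1, sum_congr rfl h2, h3, mul_sum, ← sum_add_distrib]
    have e1 := sum_aCoeff_sq_mul_factorial hq
    have e2 := sum_aCoeff_sq_mul_factorial_mul_two_mul hq
    calc _ = ∑ k ∈ range (q + 1),
          (x ^ (2 * q - 2) * (aCoeff q k ^ 2 * ((2 * k).factorial * (2 * q - 2 * k).factorial) *
            (2 * k)) - 2 * q * x ^ (2 * q - 2) *
            (aCoeff q k ^ 2 * ((2 * k).factorial * (2 * q - 2 * k).factorial))) :=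
          sum_congr rfl fun k _ => by ring
      _ = _ := by
        rw [sum_sub_distrib, ← mul_sum, ← mul_sum, e1, e2]
        ring
  · intro k hk l hl
    rw [fischerEntry_comm (by omega) (by omega), mul_comm (aCoeff q k)]
  · intro k l hkl hl
    rw [coeff_two_fischerEntry_of_lt hkl hl, smul_zero]

theorem fischerSum_aCoeff_antidiagonal (m : ℕ) (x : ℝ) :
    fischerSum (aCoeff (m + 1)) (m + 1 + 1) (2 * (m + 1)) 0 (C x) X (-C x) =
      C (cCoeff (m + 1) * x ^ (2 * (m + 1))) +
        C (-((2 * (m + 1 : ℕ) - 1) * cCoeff (m + 1)) * x ^ (2 * (m + 1) - 2)) * X ^ 2 := by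
  have h2 := coeff_two_fischerSum (show 1 ≤ m + 1 by omega) x
  rw [C_neg] at h2
  set F : ℝ[X] := fischerSum (aCoeff (m + 1)) (m + 1 + 1) (2 * (m + 1)) 0 (C x) X (-C x) with hF
  have h0 : F.coeff 0 = cCoeff (m + 1) * x ^ (2 * (m + 1)) := by
    have := map_fischerSum (aeval (0 : ℝ)) (aCoeff (m + 1)) (m + 1 + 1) (2 * (m + 1)) 0
      (C x) X (-C x)
    rw [← fischerSum_aCoeff_zero (by omega), coeff_zero_eq_eval_zero, ← coe_aeval_eq_eval, hF, this]
    simp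
  have h := derivation_fischerSum_euler (derivative' : Derivation ℝ ℝ[X] ℝ[X])
    (aCoeff (m + 1)) (n := m + 1 + 1) (N := 2 * m + 1) (e := 0) (by omega) (x := C x) (y := X)
    (z := -C x) (derivative_C) (derivative_X) (by simp)
  have hs : ∑ k ∈ range (m + 1 + 1), ∑ l ∈ range (m + 1 + 1),
      (aCoeff (m + 1) k * aCoeff (m + 1) l * ((2 * k + 0 : ℕ) + (2 * l + 0 : ℕ))) •
        fischerEntry (2 * m + 1 + 1) (2 * k + 0) (2 * l + 0) (C x) X (-C x) =
      (2 : ℝ) • F := by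
    have e := sum_add_smul_fischerEntry (aCoeff (m + 1)) (fun k => 2 * k - 1) (n := m + 1 + 1)
      (N := 2 * (m + 1)) (e := 0) (by omega) (C x) X (-C x : ℝ[X])
    have e' := sum_aCoeff_conformal (show 1 ≤ m + 1 by omega) (C x) (X : ℝ[X])
    simp only [add_zero] at e e'
    rw [e', smul_zero] at e
    rw [hF, fischerSum, ← add_zero ((2 : ℝ) • _), ← e, smul_sum, ← sum_add_distrib]
    refine sum_congr rfl fun k _ => ?_
    rw [smul_sum, ← sum_add_distrib]
    refine sum_congr rfl fun l _ => ?_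
    rw [smul_smul, add_zero, add_zero, ← add_smul]
    congr 1
    push_cast
    ring
  rw [sum_mul_aCoeff_eq_fischerSum, fischerSum_gradCoeff_antidiagonal, hs, derivative'_apply,
    show 2 * m + 1 + 1 = 2 * (m + 1) by ring, ← hF, mul_assoc, ← C_neg, ← C_mul,
    ← C_ofNat, ← C_mul] at h
  ext k
  rw [coeff_add, coeff_C, coeff_C_mul, coeff_X_pow]
  rcases Nat.eq_zero_or_pos k with rfl | hk
  · simp [h0]
  · rcases eq_or_ne k 2 with rfl | hk2
    · simp [h2]
    · obtain ⟨j, rfl⟩ : ∃ j, k = j + 1 := ⟨k - 1, by omega⟩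
      have hc := congrArg (fun p => coeff p (j + 1)) h
      simp only [coeff_add, coeff_mul_X, coeff_derivative, coeff_C_succ, add_zero, coeff_smul,
        smul_eq_mul] at hc
      have hj : (j : ℝ) - 1 ≠ 0 := by
        rw [sub_ne_zero]
        exact_mod_cast (by omega : j ≠ 1)
      have : ((j : ℝ) - 1) * F.coeff (j + 1) = 0 := by linear_combination hc
      rw [(mul_eq_zero.1 this).resolve_left hj, if_neg (by omega), if_neg (by omega)]
      simp

end

section Estimate

theorem abs_fischerEntry_le {N i j : ℕ} (hj : j ≤ N) (x y z : ℝ) :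
    |fischerEntry N i j x y z| ≤ fischerEntry N i j |x| |y| |z| := by
  rw [fischerEntry_eq_sum hj, fischerEntry_eq_sum hj]
  refine (abs_sum_le_sum_abs _ _).trans_eq (sum_congr rfl fun n _ => ?_)
  simp only [abs_mul, abs_pow, Nat.abs_cast]

theorem coeff_mul_nonneg {p q : Polynomial ℝ} (hp : ∀ n, 0 ≤ p.coeff n) (hq : ∀ n, 0 ≤ q.coeff n)
    (n : ℕ) : 0 ≤ (p * q).coeff n := by
  rw [Polynomial.coeff_mul]
  exact sum_nonneg fun a _ => mul_nonneg (hp _) (hq _)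

theorem sum_coeff_le_eval_one {p : Polynomial ℝ} (hp : ∀ n, 0 ≤ p.coeff n) (s : Finset ℕ) :
    ∑ n ∈ s, p.coeff n ≤ p.eval 1 := by
  have h : p.eval 1 = ∑ n ∈ s ∪ p.support, p.coeff n := by
    rw [Polynomial.eval_eq_sum, Polynomial.sum]
    simp only [one_pow, mul_one]
    exact sum_subset subset_union_right fun n _ hn => Polynomial.notMem_support_iff.1 hn
  rw [h]
  exact sum_le_sum_of_subset_of_nonneg subset_union_left fun n _ _ => hp n

theorem coeff_linear_pow_mul_linear_pow_nonneg {x y z : ℝ} (hx : 0 ≤ x) (hy : 0 ≤ y) (hz : 0 ≤ z)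
    (a b n : ℕ) :
    0 ≤ ((.C x + .C y * .X) ^ a * (.C y + .C z * .X) ^ b : Polynomial ℝ).coeff n := by
  refine coeff_mul_nonneg (fun k => ?_) (fun k => ?_) n <;>
    rw [coeff_C_add_C_mul_X_pow] <;> positivity

theorem sum_coeff_even_le {x y z M : ℝ} (hx : 0 ≤ x) (hy : 0 ≤ y) (hz : 0 ≤ z) (hxy : x + y ≤ M)
    (hyz : y + z ≤ M) {N j : ℕ} (hj : j ≤ N) (n : ℕ) :
    ∑ k ∈ range n,
      ((.C x + .C y * .X) ^ (N - j) * (.C y + .C z * .X) ^ j : Polynomial ℝ).coeff (2 * k) ≤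
      M ^ N := by
  have h0 := coeff_linear_pow_mul_linear_pow_nonneg hx hy hz (N - j) j
  have h1 := sum_coeff_le_eval_one h0 ((range n).image (2 * ·))
  rw [sum_image fun a _ b _ h => by simpa using h] at h1
  refine h1.trans ?_
  simp only [Polynomial.eval_mul, Polynomial.eval_pow, Polynomial.eval_add, Polynomial.eval_C,
    Polynomial.eval_X, mul_one]
  calc (x + y) ^ (N - j) * (y + z) ^ j ≤ M ^ (N - j) * M ^ j := by
        have : 0 ≤ M := (add_nonneg hx hy).trans hxy
        gcongr
    _ = M ^ N := by rw [← pow_add, Nat.sub_add_cancel hj]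

theorem factorial_mul_factorial_mul_choose_sq_le {m k : ℕ} (hk : k ≤ m) :
    (2 * k).factorial * (2 * m - 2 * k).factorial * m.choose k ^ 2 ≤
      m.factorial ^ 2 * 4 ^ m := by
  have h1 := Nat.choose_mul_factorial_mul_factorial hk
  have h2 := Nat.choose_mul_factorial_mul_factorial (show k ≤ 2 * k by omega)
  have h3 := Nat.choose_mul_factorial_mul_factorial (show m - k ≤ 2 * (m - k) by omega)
  rw [show 2 * k - k = k by omega] at h2
  rw [show 2 * (m - k) - (m - k) = m - k by omega] at h3
  rw [← Nat.mul_sub, ← h1, ← h2, ← h3]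
  calc _ = (m.choose k * k.factorial * (m - k).factorial) ^ 2 *
        ((2 * k).choose k * (2 * (m - k)).choose (m - k)) := by ring
    _ ≤ (m.choose k * k.factorial * (m - k).factorial) ^ 2 * (2 ^ (2 * k) * 2 ^ (2 * (m - k))) := by
        gcongr <;> exact Nat.choose_le_two_pow _ _
    _ = _ := by
        rw [← pow_add, ← mul_add, Nat.add_sub_cancel' hk, pow_mul]
        norm_num

/-- Schur test for a matrix of the form `d k * T k l` which is symmetric. -/
theorem sum_sum_mul_le_of_symm {n : ℕ} {f d : ℕ → ℝ} {T : ℕ → ℕ → ℝ} {A B : ℝ}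
    (hd : ∀ k < n, 0 < d k) (hT : ∀ k < n, ∀ l < n, 0 ≤ T k l)
    (hsymm : ∀ k < n, ∀ l < n, d k * T k l = d l * T l k)
    (hsum : ∀ l < n, ∑ k ∈ range n, T k l ≤ A) (hf : ∀ k < n, d k * f k ^ 2 ≤ B) (hA : 0 ≤ A) :
    ∑ k ∈ range n, ∑ l ∈ range n, f k * f l * (d k * T k l) ≤ n * B * A := by
  have key : ∀ k < n, ∀ l < n, f k * f l * (d k * T k l) ≤
      (d k * f k ^ 2 * T l k + d l * f l ^ 2 * T k l) / 2 := by
    intro k hk l hl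
    have hk0 := hd k hk
    have hl0 := hd l hl
    have e : T l k = d k * T k l / d l := by rw [hsymm k hk l hl]; field_simp
    have : (d k * f k ^ 2 * T l k + d l * f l ^ 2 * T k l) / 2 - f k * f l * (d k * T k l) =
        T k l * (d k * f k - d l * f l) ^ 2 / (2 * d l) := by
      rw [e]; field_simp; ring
    have : 0 ≤ T k l * (d k * f k - d l * f l) ^ 2 / (2 * d l) := by
      have := hT k hk l hl
      positivity
    linarith
  have hS : ∑ k ∈ range n, ∑ l ∈ range n, d k * f k ^ 2 * T l k ≤ n * B * A := by
    calc _ = ∑ k ∈ range n, d k * f k ^ 2 * ∑ l ∈ range n, T l k := by simp only [mul_sum]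
      _ ≤ ∑ k ∈ range n, B * A := by
        refine sum_le_sum fun k hk => ?_
        rw [mem_range] at hk
        have hk0 := hd k hk
        exact (mul_le_mul_of_nonneg_left (hsum k hk) (by positivity)).trans
          (mul_le_mul_of_nonneg_right (hf k hk) hA)
      _ = n * B * A := by rw [sum_const, card_range, nsmul_eq_mul, mul_assoc]
  calc _ ≤ ∑ k ∈ range n, ∑ l ∈ range n,
        (d k * f k ^ 2 * T l k + d l * f l ^ 2 * T k l) / 2 :=
        sum_le_sum fun k hk => sum_le_sum fun l hl =>
          key k (mem_range.1 hk) l (mem_range.1 hl)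
    _ = ∑ k ∈ range n, ∑ l ∈ range n, d k * f k ^ 2 * T l k := by
        simp only [← sum_div, sum_add_distrib]
        rw [sum_comm (f := fun k l => d l * f l ^ 2 * T k l)]
        ring
    _ ≤ _ := hS

theorem abs_fischerSum_hessCoeff_le (m : ℕ) {x y z M : ℝ} (hxy : |x| + |y| ≤ M)
    (hyz : |y| + |z| ≤ M) :
    |fischerSum (hessCoeff m) (m + 1) (2 * m) 0 x y z| ≤
      (m + 1 : ℕ) * 4 ^ (m + 1) * M ^ (2 * m) := by
  have hM : 0 ≤ M := (by positivity : 0 ≤ |x| + |y|).trans hxy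
  have h1 : |fischerSum (hessCoeff m) (m + 1) (2 * m) 0 x y z| ≤
      ∑ k ∈ range (m + 1), ∑ l ∈ range (m + 1), hessCoeff m k * hessCoeff m l *
        (((2 * k).factorial * (2 * m - 2 * k).factorial : ℕ) *
        ((.C |x| + .C |y| * .X) ^ (2 * m - 2 * l) * (.C |y| + .C |z| * .X) ^ (2 * l) :
          Polynomial ℝ).coeff (2 * k)) := by
    refine (abs_sum_le_sum_abs _ _).trans (sum_le_sum fun k hk => ?_)
    refine (abs_sum_le_sum_abs _ _).trans (sum_le_sum fun l hl => ?_)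
    rw [mem_range] at hk hl
    have h0 : 0 ≤ hessCoeff m k * hessCoeff m l := by unfold hessCoeff; positivity
    rw [smul_eq_mul, abs_mul, abs_of_nonneg h0]
    exact mul_le_mul_of_nonneg_left (abs_fischerEntry_le (by omega) x y z) h0
  refine h1.trans ((sum_sum_mul_le_of_symm (B := 4 ^ (m + 1)) (A := M ^ (2 * m))
    (d := fun k => ((2 * k).factorial * (2 * m - 2 * k).factorial : ℕ)) (f := hessCoeff m)
    (T := fun k l => ((.C |x| + .C |y| * .X) ^ (2 * m - 2 * l) *
      (.C |y| + .C |z| * .X) ^ (2 * l) : Polynomial ℝ).coeff (2 * k))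
    ?_ ?_ ?_ ?_ ?_ (by positivity)))
  · intro k _
    positivity
  · intro k _ l _
    exact coeff_linear_pow_mul_linear_pow_nonneg (abs_nonneg _) (abs_nonneg _) (abs_nonneg _) _ _ _
  · intro k hk l hl
    exact fischerEntry_comm (by omega) (by omega) |x| |y| |z|
  · intro l hl
    exact sum_coeff_even_le (abs_nonneg _) (abs_nonneg _) (abs_nonneg _) hxy hyz (by omega) _
  · intro k hk
    have h := factorial_mul_factorial_mul_choose_sq_le (Nat.lt_succ_iff.1 hk)
    rify at h
    have hm : (0 : ℝ) < m.factorial := by positivity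
    unfold hessCoeff
    push_cast
    calc _ = 4 / (m.factorial : ℝ) ^ 2 *
          ((2 * k).factorial * (2 * m - 2 * k).factorial * m.choose k ^ 2) := by ring
      _ ≤ 4 / (m.factorial : ℝ) ^ 2 * (m.factorial ^ 2 * 4 ^ m) := by gcongr
      _ = 4 ^ (m + 1) := by field_simp; ring

theorem abs_le_mul_sq_of_hasDerivAt {g g' g'' : ℝ → ℝ} {a b K : ℝ}
    (hg : ∀ t, HasDerivAt g (g' t) t) (hg' : ∀ t, HasDerivAt g' (g'' t) t) (ha : g a = 0)
    (ha' : g' a = 0) (hK : ∀ t ∈ Set.uIcc a b, |g'' t| ≤ K) : |g b| ≤ K * (b - a) ^ 2 := by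
  have hK0 : 0 ≤ K := (abs_nonneg _).trans (hK a Set.left_mem_uIcc)
  have h1 : ∀ t ∈ Set.uIcc a b, |g' t| ≤ K * |b - a| := by
    intro t ht
    have h := (convex_uIcc a b).norm_image_sub_le_of_norm_hasDerivWithin_le
      (fun s _ => (hg' s).hasDerivWithinAt) hK Set.left_mem_uIcc ht
    rw [ha', sub_zero, Real.norm_eq_abs, Real.norm_eq_abs] at h
    exact h.trans (mul_le_mul_of_nonneg_left (Set.abs_sub_left_of_mem_uIcc ht) hK0)
  have h := (convex_uIcc a b).norm_image_sub_le_of_norm_hasDerivWithin_le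
    (fun s _ => (hg s).hasDerivWithinAt) h1 Set.left_mem_uIcc Set.right_mem_uIcc
  rw [ha, sub_zero, Real.norm_eq_abs, Real.norm_eq_abs, mul_assoc, ← sq, sq_abs] at h
  exact h

theorem eval_fischerSum (t : ℝ) (c : ℕ → ℝ) (n N e : ℕ) (x y z : Polynomial ℝ) :
    (fischerSum c n N e x y z).eval t =
      fischerSum c n N e (x.eval t) (y.eval t) (z.eval t) := by
  simpa only [Polynomial.coe_aeval_eq_eval] using map_fischerSum (Polynomial.aeval t) c n N e x y z

theorem hasDerivAt_fischerSum (c : ℕ → ℝ) (n N e : ℕ) (x y t : ℝ) :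
    HasDerivAt (fun t => fischerSum c n N e x y t)
      ((Polynomial.derivative
        (fischerSum c n N e (.C x) (.C y) (.X : Polynomial ℝ))).eval t) t := by
  have h := (fischerSum c n N e (.C x) (.C y) (.X : Polynomial ℝ)).hasDerivAt t
  simpa only [eval_fischerSum, Polynomial.eval_C, Polynomial.eval_X] using h

theorem abs_Ppoly_succ_le (m : ℕ) (x y z : ℝ) :
    |Ppoly (m + 1) x y z| ≤ (m + 1 : ℕ) * 4 ^ (m + 1) *
      max (|x| + |y|) (|y| + |z|) ^ (2 * m) * (x + z) ^ 2 := by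
  rw [show (x + z) ^ 2 = (z - -x) ^ 2 by ring]
  refine abs_le_mul_sq_of_hasDerivAt (g := fun t => Ppoly (m + 1) x y t)
    (g' := fun t => fischerSum (gradCoeff m) (m + 1) (2 * m + 1) 1 x y t +
      cCoeff (m + 1) * x ^ (2 * m + 1))
    (g'' := fun t => fischerSum (hessCoeff m) (m + 1) (2 * m) 0 x y t) ?_ ?_ ?_ ?_ ?_
  · intro t
    have h := hasDerivAt_fischerSum (aCoeff (m + 1)) (m + 1 + 1) (2 * (m + 1)) 0 x y t
    rw [derivative_fischerSum_aCoeff, eval_fischerSum, Polynomial.eval_C, Polynomial.eval_C,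
      Polynomial.eval_X] at h
    unfold Ppoly
    simp only [Ptilde_eq_fischerSum]
    have h' := (((hasDerivAt_id t).const_mul (x ^ (2 * (m + 1) - 1))).add_const
      ((2 * ((m + 1 : ℕ) : ℝ) - 1) * x ^ (2 * (m + 1) - 2) * y ^ 2)).const_mul (cCoeff (m + 1))
    rw [mul_one] at h'
    exact h.add h'
  · intro t
    have h := hasDerivAt_fischerSum (gradCoeff m) (m + 1) (2 * m + 1) 1 x y t
    rw [derivative_fischerSum_gradCoeff, eval_fischerSum, Polynomial.eval_C, Polynomial.eval_C,
      Polynomial.eval_X] at h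
    exact h.add_const _
  · have h := congrArg (Polynomial.eval y) (fischerSum_aCoeff_antidiagonal m x)
    simp only [eval_fischerSum, Polynomial.eval_C, Polynomial.eval_X, Polynomial.eval_add,
      Polynomial.eval_mul, Polynomial.eval_neg, Polynomial.eval_pow] at h
    unfold Ppoly
    rw [Ptilde_eq_fischerSum, h, show 2 * (m + 1) - 1 = 2 * m + 1 by omega]
    ring
  · have h := congrArg (Polynomial.eval y) (fischerSum_gradCoeff_antidiagonal m x)
    simp only [eval_fischerSum, Polynomial.eval_C, Polynomial.eval_X, Polynomial.eval_neg] at h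
    simp only [h, neg_add_cancel]
  · intro t ht
    refine abs_fischerSum_hessCoeff_le m (le_max_left _ _) ?_
    have h : |t| ≤ max |x| |z| := by
      rw [Set.mem_uIcc] at ht
      rcases ht with ht | ht
      · exact abs_le.2 ⟨by linarith [le_abs_self x, le_max_left |x| |z|],
          ht.2.trans ((le_abs_self z).trans (le_max_right _ _))⟩
      · exact abs_le.2 ⟨by linarith [neg_abs_le z, le_max_right |x| |z|],
          ht.2.trans ((neg_le_abs x).trans (le_max_left _ _))⟩
    rw [add_comm |x|, max_add_add_left]
    gcongr

theorem one_le_exp_one_sq_div_sqrt_pi : 1 ≤ Real.exp 1 ^ 2 / √Real.pi := by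
  rw [one_le_div (Real.sqrt_pos.2 Real.pi_pos)]
  have h1 : √Real.pi ≤ 2 := Real.sqrt_le_iff.2 ⟨by norm_num, by linarith [Real.pi_le_four]⟩
  have h2 : 2 ≤ Real.exp 1 := by linarith [Real.add_one_le_exp 1]
  nlinarith

end Estimate

/-- For every `q ≥ 1` and all reals `x,y,z`, with `M = max(|x|+|y|, |y|+|z|)`,
`|P_q(x,y,z)| ≤ (e²/√π) q^{3/2} 4^q M^{2q−2} (x+z)²`. -/
theorem Ppoly_bound (q : ℕ) (hq : 1 ≤ q) (x y z : ℝ) :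
    |Ppoly q x y z| ≤
      (Real.exp 1 ^ 2 / Real.sqrt Real.pi) * (q : ℝ) ^ ((3 : ℝ) / 2) * 4 ^ q *
        max (|x| + |y|) (|y| + |z|) ^ (2 * q - 2) * (x + z) ^ 2 := by
  obtain ⟨m, rfl⟩ : ∃ m, q = m + 1 := ⟨q - 1, by omega⟩
  refine (abs_Ppoly_succ_le m x y z).trans ?_
  rw [show 2 * (m + 1) - 2 = 2 * m by omega]
  have h1 : ((m + 1 : ℕ) : ℝ) ≤ ((m + 1 : ℕ) : ℝ) ^ ((3 : ℝ) / 2) :=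
    Real.self_le_rpow_of_one_le (by exact_mod_cast hq) (by norm_num)
  have h2 : ((m + 1 : ℕ) : ℝ) ≤
      Real.exp 1 ^ 2 / √Real.pi * ((m + 1 : ℕ) : ℝ) ^ ((3 : ℝ) / 2) :=
    h1.trans (le_mul_of_one_le_left (by positivity) one_le_exp_one_sq_div_sqrt_pi)
  gcongr
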